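/- (Local competitiveness) Let σ be an ALG-schedule and σ_O any schedule of the same instance, and assume 1/(1−α) is an integer. Then at every time t ≥ 0 it holds that |A(t) ∖ O(t)| ≤ (3 + 2/(1−α)) · |O(t)|. -/

import Mathlib

open MeasureTheory Set

open scoped Classical

noncomputable section

variable {J : Type*}

/-- Total work done on job `j` by time `u` under the schedule `σ`. -/
def workDone (σ : ℝ → J → ℝ) (j : J) (u : ℝ) : ℝ := ∫ v in (0:ℝ)..u, σ v j

/-- Remaining processing time of job `j` at time `u`. -/
def remT (p : J → ℝ) (σ : ℝ → J → ℝ) (j : J) (u : ℝ) : ℝ := p j - workDone σ j u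

/-- Completion time of job `j`: the least `u` with `workDone σ j u = p j`,
    and `⊤` if the job never completes. -/
def cTime (p : J → ℝ) (σ : ℝ → J → ℝ) (j : J) : EReal :=
  sInf ((fun v : ℝ => (v : EReal)) '' {v : ℝ | workDone σ j v = p j})

/-- Job `j` is available at time `u`: released and not yet completed. -/
def availAt (r p : J → ℝ) (σ : ℝ → J → ℝ) (u : ℝ) (j : J) : Prop :=
  r j ≤ u ∧ (u : EReal) < cTime p σ j

/-- Job `j` is processed at time `u`. -/
def procAt (σ : ℝ → J → ℝ) (u : ℝ) (j : J) : Prop := 0 < σ u j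

/-- Job `j` is non-clairvoyant at time `u`. -/
def ncAt (r p : J → ℝ) (α : ℝ) (σ : ℝ → J → ℝ) (u : ℝ) (j : J) : Prop :=
  availAt r p σ u j ∧ workDone σ j u ≤ α * p j

/-- Job `j` is clairvoyant at time `u`. -/
def clAt (r p : J → ℝ) (α : ℝ) (σ : ℝ → J → ℝ) (u : ℝ) (j : J) : Prop :=
  availAt r p σ u j ∧ α * p j < workDone σ j u

/-- The time at which job `j` emits its signal: the least `u` with
    `workDone σ j u = α * p j`. -/
def emitT (p : J → ℝ) (α : ℝ) (σ : ℝ → J → ℝ) (j : J) : ℝ :=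
  sInf {u : ℝ | workDone σ j u = α * p j}

/-- Data of an instance: nonnegative release dates, positive processing times
    and `α ∈ (0,1)`. -/
structure IsInstance (r p : J → ℝ) (α : ℝ) : Prop where
  r_nonneg : ∀ j, 0 ≤ r j
  p_pos : ∀ j, 0 < p j
  alpha_mem : α ∈ Set.Ioo (0 : ℝ) 1

/-- `σ` is a (feasible, preemptive, single machine) schedule. -/
structure IsSchedule [Fintype J] (r p : J → ℝ) (σ : ℝ → J → ℝ) : Prop where
  meas : ∀ j, Measurable fun u => σ u j
  nonneg : ∀ u j, 0 ≤ σ u j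
  sum_le_one : ∀ u, ∑ j, σ u j ≤ 1
  zero_before_release : ∀ u j, u < r j → σ u j = 0
  workDone_le : ∀ u j, workDone σ j u ≤ p j

/-- A schedule is non-idling if it uses the full machine capacity whenever
    some job is available. -/
def NonIdling [Fintype J] (r p : J → ℝ) (σ : ℝ → J → ℝ) : Prop :=
  ∀ u, (∃ j, availAt r p σ u j) → ∑ j, σ u j = 1

/-- The SRPT condition at time `u`: `Cl(u) ≠ ∅` and
    `min_{j ∈ Cl(u)} p_j(u) ≤ ((1-α)/α) · min_{j ∈ N(u)} y_j(u)`
    (the minimum over the empty set being `+∞`). -/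
def SrptCond (r p : J → ℝ) (α : ℝ) (σ : ℝ → J → ℝ) (u : ℝ) : Prop :=
  ∃ k, clAt r p α σ u k ∧
    ∀ j, ncAt r p α σ u j → remT p σ k u ≤ ((1 - α) / α) * workDone σ j u

/-- `k` is a clairvoyant job of minimal remaining processing time at `u`,
    emitting last among those. -/
def IsSrptChoice (r p : J → ℝ) (α : ℝ) (σ : ℝ → J → ℝ) (u : ℝ) (k : J) : Prop :=
  clAt r p α σ u k ∧
    (∀ j, clAt r p α σ u j → remT p σ k u ≤ remT p σ j u) ∧
    (∀ j, clAt r p α σ u j → remT p σ j u = remT p σ k u →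
      emitT p α σ j ≤ emitT p α σ k)

/-- `j` is a non-clairvoyant job with minimal progress at time `u`. -/
def IsMinNc (r p : J → ℝ) (α : ℝ) (σ : ℝ → J → ℝ) (u : ℝ) (j : J) : Prop :=
  ncAt r p α σ u j ∧ ∀ j', ncAt r p α σ u j' → workDone σ j u ≤ workDone σ j' u

/-- `σ` is an ALG-schedule: non-idling, and at any time with available jobs it
    either runs a single clairvoyant job of shortest remaining processing time
    (breaking ties by latest emission) when the SRPT condition holds, or it runs
    exactly the non-clairvoyant jobs of minimal progress at equal rates. -/
structure IsALG [Fintype J] (r p : J → ℝ) (α : ℝ) (σ : ℝ → J → ℝ) : Prop where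
  sched : IsSchedule r p σ
  nonidling : NonIdling r p σ
  srpt_branch : ∀ u, (∃ j, availAt r p σ u j) → SrptCond r p α σ u →
    ∃ k, IsSrptChoice r p α σ u k ∧ ∀ j, j ≠ k → σ u j = 0
  setf_branch : ∀ u, (∃ j, availAt r p σ u j) → ¬ SrptCond r p α σ u →
    (∀ j, procAt σ u j → IsMinNc r p α σ u j) ∧
    (∀ j j', IsMinNc r p α σ u j → IsMinNc r p α σ u j' → σ u j = σ u j')

/-- Right endpoint `min (C_j, t)` of the lifetime of `j` w.r.t. reference time `t`. -/
def lifeEnd (p : J → ℝ) (σ : ℝ → J → ℝ) (t : ℝ) (j : J) : ℝ :=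
  (min (cTime p σ j) (t : EReal)).toReal

/-- The lifetime `I_j = [r j, min (C_j, t)]` of job `j`. -/
def lifetime (r p : J → ℝ) (σ : ℝ → J → ℝ) (t : ℝ) (j : J) : Set ℝ :=
  Set.Icc (r j) (lifeEnd p σ t j)

/-- `E_N`-edge of the borrow graph: `i` is processed at some time of `I_j`
    while being non-clairvoyant. -/
def ENedge (r p : J → ℝ) (α : ℝ) (σ : ℝ → J → ℝ) (t : ℝ) (j i : J) : Prop :=
  ∃ u ∈ lifetime r p σ t j, procAt σ u i ∧ ncAt r p α σ u i

/-- `E_C`-edge of the borrow graph: `i` is processed at some time of `I_j`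
    while being clairvoyant. -/
def ECedge (r p : J → ℝ) (α : ℝ) (σ : ℝ → J → ℝ) (t : ℝ) (j i : J) : Prop :=
  ∃ u ∈ lifetime r p σ t j, procAt σ u i ∧ clAt r p α σ u i

/-- Edge of the borrow graph `G_B`. -/
def borrowEdge (r p : J → ℝ) (α : ℝ) (σ : ℝ → J → ℝ) (t : ℝ) (j i : J) : Prop :=
  ENedge r p α σ t j i ∨ ECedge r p α σ t j i

/-- `reaches j i` iff `i ∈ R_j`, i.e. `i` is reachable from `j` in the borrow
    graph (`j` itself included). -/
def reaches (r p : J → ℝ) (α : ℝ) (σ : ℝ → J → ℝ) (t : ℝ) : J → J → Prop :=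
  Relation.ReflTransGen (borrowEdge r p α σ t)

/-- Truncated progress `ȳ_j = min (y_j(t), α p_j)`. -/
def truncY (p : J → ℝ) (α : ℝ) (σ : ℝ → J → ℝ) (t : ℝ) (j : J) : ℝ :=
  min (workDone σ j t) (α * p j)

end

namespace IsSchedule

variable {J : Type*} [Fintype J] {r p : J → ℝ} {σ : ℝ → J → ℝ}

theorem le_one (h : IsSchedule r p σ) (u : ℝ) (j : J) : σ u j ≤ 1 :=
  (Finset.single_le_sum (fun i _ => h.nonneg u i) (Finset.mem_univ j)).trans (h.sum_le_one u)

theorem intervalIntegrable (h : IsSchedule r p σ) (j : J) (a b : ℝ) :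
    IntervalIntegrable (fun v => σ v j) volume a b := by
  refine (intervalIntegrable_const (c := (1 : ℝ))).mono_fun (h.meas j).aestronglyMeasurable ?_
  refine Filter.Eventually.of_forall fun u => ?_
  simpa [abs_of_nonneg (h.nonneg u j)] using h.le_one u j

theorem workDone_sub (h : IsSchedule r p σ) (j : J) (a b : ℝ) :
    workDone σ j b - workDone σ j a = ∫ v in a..b, σ v j :=
  intervalIntegral.integral_interval_sub_left (h.intervalIntegrable j 0 b)
    (h.intervalIntegrable j 0 a)

theorem workDone_mono (h : IsSchedule r p σ) (j : J) : Monotone (workDone σ j) := fun a b hab => by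
  have h1 := h.workDone_sub j a b
  have h2 : 0 ≤ ∫ v in a..b, σ v j :=
    intervalIntegral.integral_nonneg hab fun u _ => h.nonneg u j
  linarith

theorem workDone_continuous (h : IsSchedule r p σ) (j : J) : Continuous (workDone σ j) :=
  intervalIntegral.continuous_primitive (h.intervalIntegrable j) 0

theorem workDone_of_le_release (h : IsSchedule r p σ) {j : J} (hr : 0 ≤ r j) {u : ℝ}
    (hu : u ≤ r j) : workDone σ j u = 0 := by
  have h1 := h.workDone_sub j u 0
  have h0 : workDone σ j 0 = 0 := by simp [workDone]
  have key : ∀ a b, a ≤ b → b ≤ r j → ∫ v in a..b, σ v j = 0 := fun a b hab hb => by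
    rw [intervalIntegral.integral_of_le hab, integral_Ioc_eq_integral_Ioo]
    exact setIntegral_eq_zero_of_forall_eq_zero fun v hv =>
      h.zero_before_release v j (hv.2.trans_le hb)
  rcases le_total u 0 with hu0 | hu0
  · linarith [key u 0 hu0 hr]
  · exact key 0 u hu0 hu

theorem workDone_nonneg (h : IsSchedule r p σ) {j : J} (hr : 0 ≤ r j) (u : ℝ) :
    0 ≤ workDone σ j u := by
  rcases le_total u (r j) with hu | hu
  · exact (h.workDone_of_le_release hr hu).ge
  · exact (h.workDone_of_le_release hr le_rfl).ge.trans (h.workDone_mono j hu)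

theorem availAt_iff (h : IsSchedule r p σ) {j : J} {u : ℝ} :
    availAt r p σ u j ↔ r j ≤ u ∧ workDone σ j u < p j := by
  refine and_congr_right fun _ => ⟨fun hu => ?_, fun hu => ?_⟩
  · refine lt_of_le_of_ne (h.workDone_le u j) fun he => ?_
    exact absurd (sInf_le (Set.mem_image_of_mem _ he) : cTime p σ j ≤ u) (not_le.2 hu)
  · obtain ⟨w, huw, hw⟩ : ∃ w, u < w ∧ workDone σ j w < p j := by
      have h1 := ((h.workDone_continuous j).tendsto u).eventually_lt_const hu
      obtain ⟨w, hw⟩ := ((h1.filter_mono nhdsWithin_le_nhds).and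
        (self_mem_nhdsWithin : Set.Ioi u ∈ nhdsWithin u (Set.Ioi u))).exists
      exact ⟨w, hw.2, hw.1⟩
    refine lt_of_lt_of_le (EReal.coe_lt_coe_iff.2 huw) (le_sInf ?_)
    rintro _ ⟨v, hv, rfl⟩
    refine EReal.coe_le_coe_iff.2 (le_of_not_gt fun hvw => ?_)
    have := h.workDone_mono j hvw.le
    replace hv : workDone σ j v = p j := hv
    linarith

/-- While the progress of a job climbs from `a` to `b`, the job is processed at some time. -/
theorem exists_pos_of_climb (h : IsSchedule r p σ) {j : J} {u₁ u₂ a b : ℝ} (hu : u₁ ≤ u₂)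
    (hab : a < b) (h₁ : workDone σ j u₁ ≤ a) (h₂ : b ≤ workDone σ j u₂) :
    ∃ u ∈ Set.Ioo u₁ u₂, a ≤ workDone σ j u ∧ workDone σ j u ≤ b ∧ 0 < σ u j := by
  have hc := (h.workDone_continuous j).continuousOn (s := Set.Icc u₁ u₂)
  obtain ⟨v, hv, hva⟩ := intermediate_value_Icc hu hc ⟨h₁, hab.le.trans h₂⟩
  obtain ⟨w, hw, hwb⟩ := intermediate_value_Icc hu hc ⟨h₁.trans hab.le, h₂⟩
  have hvw : v < w := (h.workDone_mono j).reflect_lt (by rw [hva, hwb]; exact hab)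
  by_contra! hcon
  have h0 : ∫ x in v..w, σ x j = 0 := by
    rw [intervalIntegral.integral_of_le hvw.le, integral_Ioc_eq_integral_Ioo]
    refine setIntegral_eq_zero_of_forall_eq_zero fun x hx => ?_
    refine le_antisymm (hcon x ⟨hv.1.trans_lt hx.1, hx.2.trans_le hw.2⟩ ?_ ?_) (h.nonneg x j)
    · rw [← hva]; exact h.workDone_mono j hx.1.le
    · rw [← hwb]; exact h.workDone_mono j hx.2.le
  have := h.workDone_sub j v w
  linarith

end IsSchedule

/-- Optimistic remaining processing time: exact for clairvoyant jobs, and the remaining time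
of a job emitting its signal right now for non-clairvoyant ones. -/
noncomputable def optRem {J : Type*} (p : J → ℝ) (α : ℝ) (σ : ℝ → J → ℝ) (j : J) (u : ℝ) : ℝ :=
  min ((1 - α) / α * workDone σ j u) (remT p σ j u)

theorem optRem_of_le {J : Type*} {p : J → ℝ} {α : ℝ} {σ : ℝ → J → ℝ} {j : J} {u : ℝ}
    (hα : α ∈ Set.Ioo (0 : ℝ) 1) (h : workDone σ j u ≤ α * p j) :
    optRem p α σ j u = (1 - α) / α * workDone σ j u := by
  refine min_eq_left ?_
  have := hα.1
  rw [remT, div_mul_eq_mul_div, div_le_iff₀ hα.1]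
  nlinarith

theorem optRem_of_ge {J : Type*} {p : J → ℝ} {α : ℝ} {σ : ℝ → J → ℝ} {j : J} {u : ℝ}
    (hα : α ∈ Set.Ioo (0 : ℝ) 1) (h : α * p j ≤ workDone σ j u) :
    optRem p α σ j u = remT p σ j u := by
  refine min_eq_right ?_
  have := hα.1
  rw [remT, div_mul_eq_mul_div, le_div_iff₀ hα.1]
  nlinarith

namespace IsALG

variable {J : Type*} [Fintype J] {r p : J → ℝ} {α : ℝ} {σ : ℝ → J → ℝ}

/-- The algorithm processes only jobs of minimal optimistic remaining processing time. -/
theorem optRem_le_of_pos (hα : α ∈ Set.Ioo (0 : ℝ) 1) (h : IsALG r p α σ) {u : ℝ} {i j : J}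
    (hj : availAt r p σ u j) (hi : 0 < σ u i) : optRem p α σ i u ≤ optRem p α σ j u := by
  by_cases hs : SrptCond r p α σ u
  · obtain ⟨k, hk, hk0⟩ := h.srpt_branch u ⟨j, hj⟩ hs
    obtain rfl : i = k := by
      by_contra hne
      exact hi.ne' (hk0 i hne)
    rw [optRem_of_ge hα hk.1.2.le]
    rcases le_or_gt (workDone σ j u) (α * p j) with hN | hC
    · obtain ⟨k', hk', hle⟩ := hs
      rw [optRem_of_le hα hN]
      exact (hk.2.1 k' hk').trans (hle j ⟨hj, hN⟩)
    · rw [optRem_of_ge hα hC.le]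
      exact hk.2.1 j ⟨hj, hC⟩
  · have hβ : 0 ≤ (1 - α) / α := div_nonneg (by linarith [hα.2]) hα.1.le
    have hi' := (h.setf_branch u ⟨j, hj⟩ hs).1 i hi
    rw [optRem_of_le hα hi'.1.2]
    rcases le_or_gt (workDone σ j u) (α * p j) with hN | hC
    · rw [optRem_of_le hα hN]
      exact mul_le_mul_of_nonneg_left (hi'.2 j ⟨hj, hN⟩) hβ
    · rw [optRem_of_ge hα hC.le]
      simp only [SrptCond, not_exists, not_and, not_forall, not_le] at hs
      obtain ⟨j₀, hj₀, hlt⟩ := hs j ⟨hj, hC⟩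
      exact (mul_le_mul_of_nonneg_left (hi'.2 j₀ hj₀) hβ).trans hlt.le

/-- A processed clairvoyant job is processed alone. -/
theorem eq_zero_of_clairvoyant (h : IsALG r p α σ) {u : ℝ} {i j : J} (hij : j ≠ i)
    (hav : availAt r p σ u i) (hc : α * p i < workDone σ i u) (hi : 0 < σ u i) : σ u j = 0 := by
  by_cases hs : SrptCond r p α σ u
  · obtain ⟨k, -, hk0⟩ := h.srpt_branch u ⟨i, hav⟩ hs
    obtain rfl : i = k := by
      by_contra hne
      exact hi.ne' (hk0 i hne)
    exact hk0 j hij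
  · exact absurd ((h.setf_branch u ⟨i, hav⟩ hs).1 i hi).1.2 (not_le.2 hc)

/-- Two clairvoyant jobs that start with equal remaining processing times and end with equal
ones have equal remaining processing times throughout. -/
theorem remT_le_of_tied (hα : α ∈ Set.Ioo (0 : ℝ) 1) (h : IsALG r p α σ) {i j : J} {a b : ℝ}
    (hi : r i ≤ a) (hcj : α * p j ≤ workDone σ j a) (hbi : workDone σ i b < p i)
    (heq : remT p σ i b = remT p σ j b) {u : ℝ} (hu : u ∈ Set.Icc a b) :
    remT p σ j u ≤ remT p σ i u := by
  by_contra! hlt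
  have hS := h.sched
  have hmi := hS.workDone_mono i hu.2
  simp only [remT] at *
  obtain ⟨v, hv, hva, hvb, hpos⟩ := hS.exists_pos_of_climb (j := j) hu.2
    (a := workDone σ j u) (b := p j - ((p j - workDone σ j u) + (p i - workDone σ i u)) / 2)
    (by linarith) le_rfl (by linarith)
  have hvj := hS.workDone_mono j (hu.1.trans hv.1.le)
  have hvi := hS.workDone_mono i hv.1.le
  have hvi' := hS.workDone_mono i hv.2.le
  have hav : availAt r p σ v i := hS.availAt_iff.2 ⟨by linarith [hu.1, hv.1], by linarith⟩
  have h1 := h.optRem_le_of_pos hα hav hpos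
  rw [optRem_of_ge hα (hcj.trans hvj)] at h1
  have h2 : optRem p α σ i v ≤ remT p σ i v := min_le_right _ _
  simp only [remT] at h1 h2
  linarith

/-- Two clairvoyant jobs with equal remaining processing times at both ends of a period are
not processed in between. -/
theorem workDone_eq_of_tied (hα : α ∈ Set.Ioo (0 : ℝ) 1) (h : IsALG r p α σ) {i j : J}
    (hij : i ≠ j) {a b : ℝ} (hab : a ≤ b) (hi : r i ≤ a) (hj : r j ≤ a)
    (hci : α * p i ≤ workDone σ i a) (hcj : α * p j ≤ workDone σ j a)
    (hbi : workDone σ i b < p i) (hbj : workDone σ j b < p j)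
    (heq : remT p σ i b = remT p σ j b) :
    workDone σ i b = workDone σ i a := by
  have hS := h.sched
  have tied : ∀ u ∈ Set.Icc a b, remT p σ i u = remT p σ j u := fun u hu =>
    le_antisymm (h.remT_le_of_tied hα hj hci hbj heq.symm hu)
      (h.remT_le_of_tied hα hi hcj hbi heq hu)
  by_contra hne
  have hlt : workDone σ i a < workDone σ i b := lt_of_le_of_ne (hS.workDone_mono i hab) (Ne.symm hne)
  obtain ⟨c, hc, hcm⟩ := intermediate_value_Icc hab (hS.workDone_continuous i).continuousOn
    (show (workDone σ i a + workDone σ i b) / 2 ∈ Set.Icc _ _ by constructor <;> linarith)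
  have hzero : ∫ v in c..b, σ v i = 0 := by
    refine intervalIntegral.integral_zero_ae ?_
    filter_upwards [(hS.intervalIntegrable i a b).ae_hasDerivAt_integral,
      (hS.intervalIntegrable j a b).ae_hasDerivAt_integral, volume.ae_ne b] with u hdi hdj hub hu
    rw [Set.uIoc_of_le hc.2] at hu
    have hu' : u ∈ Set.Ioo a b := ⟨hc.1.trans_lt hu.1, lt_of_le_of_ne hu.2 hub⟩
    have hσ : σ u i = σ u j := by
      have huab : u ∈ Set.uIcc a b := Set.uIcc_of_le hab ▸ ⟨hu'.1.le, hu'.2.le⟩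
      refine (hdi huab a Set.left_mem_uIcc).unique
        ((hdj huab a Set.left_mem_uIcc).congr_of_eventuallyEq ?_)
      filter_upwards [Icc_mem_nhds hu'.1 hu'.2] with v hv
      have h1 := tied v hv
      have h2 := tied a ⟨le_rfl, hab⟩
      simp only [remT] at h1 h2
      rw [← hS.workDone_sub, ← hS.workDone_sub]
      linarith
    by_contra hpos
    replace hpos : 0 < σ u i := lt_of_le_of_ne (hS.nonneg u i) (Ne.symm hpos)
    have hcu := hS.workDone_mono i hu.1.le
    have hub' := hS.workDone_mono i hu.2
    have := h.eq_zero_of_clairvoyant hij.symm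
      (hS.availAt_iff.2 ⟨by linarith [hu'.1], by linarith⟩) (by linarith) hpos
    linarith
  have := hS.workDone_sub i c b
  linarith

end IsALG

/-- The last time up to `t` at which all available jobs have optimistic remaining processing
time at least `x`. -/
noncomputable def levelTime {J : Type*} (r p : J → ℝ) (α : ℝ) (σ : ℝ → J → ℝ) (t x : ℝ) : ℝ :=
  sSup {u | u ≤ t ∧ ∀ j, availAt r p σ u j → x ≤ optRem p α σ j u}

/-- Job `j` is released before the level time for `x`, and processed thereafter. -/
def CrossesLevel {J : Type*} (r p : J → ℝ) (α : ℝ) (σ : ℝ → J → ℝ) (t x : ℝ) (j : J) : Prop :=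
  r j < levelTime r p α σ t x ∧ workDone σ j (levelTime r p α σ t x) < p j ∧
    workDone σ j (levelTime r p α σ t x) < workDone σ j t

section levelTime

variable {J : Type*} {r p : J → ℝ} {α : ℝ} {σ : ℝ → J → ℝ} {t x : ℝ}

theorem bddAbove_levelTime :
    BddAbove {u | u ≤ t ∧ ∀ j, availAt r p σ u j → x ≤ optRem p α σ j u} :=
  ⟨t, fun _ hu => hu.1⟩

theorem nonempty_levelTime (hinst : IsInstance r p α) (ht : 0 ≤ t) :
    {u | u ≤ t ∧ ∀ j, availAt r p σ u j → x ≤ optRem p α σ j u}.Nonempty :=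
  ⟨-1, by linarith, fun j hj => by linarith [hj.1, hinst.r_nonneg j]⟩

theorem levelTime_le (hinst : IsInstance r p α) (ht : 0 ≤ t) : levelTime r p α σ t x ≤ t :=
  csSup_le (nonempty_levelTime hinst ht) fun _ hu => hu.1

theorem levelTime_anti (hinst : IsInstance r p α) (ht : 0 ≤ t) :
    Antitone (levelTime r p α σ t) := fun _ _ hxy =>
  csSup_le_csSup bddAbove_levelTime (nonempty_levelTime hinst ht)
    fun _ hu => ⟨hu.1, fun j hj => hxy.trans (hu.2 j hj)⟩

theorem exists_optRem_lt {u : ℝ} (hu : u ∈ Set.Ioc (levelTime r p α σ t x) t) :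
    ∃ j, availAt r p σ u j ∧ optRem p α σ j u < x := by
  by_contra! hcon
  exact absurd (le_csSup bddAbove_levelTime ⟨hu.2, hcon⟩) (not_le.2 hu.1)

variable [Fintype J]

theorem optRem_lt_of_pos (hα : α ∈ Set.Ioo (0 : ℝ) 1) (h : IsALG r p α σ) {u : ℝ}
    (hu : u ∈ Set.Ioc (levelTime r p α σ t x) t) {i : J} (hi : 0 < σ u i) :
    optRem p α σ i u < x := by
  obtain ⟨j, hj, hjx⟩ := exists_optRem_lt hu
  exact (h.optRem_le_of_pos hα hj hi).trans_lt hjx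

theorem le_optRem_levelTime (hinst : IsInstance r p α) (h : IsALG r p α σ) (ht : 0 ≤ t) {j : J}
    (hr : r j < levelTime r p α σ t x) (hp : workDone σ j (levelTime r p α σ t x) < p j) :
    x ≤ optRem p α σ j (levelTime r p α σ t x) := by
  by_contra! hlt
  have hS := h.sched
  have hc : Continuous (optRem p α σ j) :=
    ((hS.workDone_continuous j).const_mul _).min
      (continuous_const.sub (hS.workDone_continuous j))
  obtain ⟨l, hl, hsub⟩ := exists_Ioc_subset_of_mem_nhds
    ((hc.tendsto _).eventually_lt_const hlt) ⟨r j, hr⟩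
  obtain ⟨u, hu, hlu⟩ := exists_lt_of_lt_csSup (nonempty_levelTime hinst ht) (max_lt hl hr)
  have hus := le_csSup bddAbove_levelTime hu
  have h1 : optRem p α σ j u < x := hsub ⟨(le_max_left _ _).trans_lt hlu, hus⟩
  exact absurd (hu.2 j (hS.availAt_iff.2 ⟨((le_max_right _ _).trans_lt hlu).le,
    (hS.workDone_mono j hus).trans_lt hp⟩)) (not_le.2 h1)

theorem not_pos_of_level (hα : α ∈ Set.Ioo (0 : ℝ) 1) (h : IsALG r p α σ) {u : ℝ}
    (hu : u ∈ Set.Ioc (levelTime r p α σ t x) t) {i : J}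
    (h₁ : α / (1 - α) * x ≤ workDone σ i u) (h₂ : workDone σ i u ≤ p i - x) : ¬ 0 < σ u i := by
  intro hi
  refine absurd (optRem_lt_of_pos hα h hu hi) (not_lt.2 (le_min ?_ ?_))
  · have h3 : 0 < 1 - α := by linarith [hα.2]
    rw [div_mul_eq_mul_div, div_le_iff₀ h3] at h₁
    rw [div_mul_eq_mul_div, le_div_iff₀ hα.1]
    linarith
  · simp only [remT]; linarith

theorem CrossesLevel.workDone_eq (hinst : IsInstance r p α) (h : IsALG r p α σ) (ht : 0 ≤ t)
    {j : J} (hj : CrossesLevel r p α σ t x j) :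
    workDone σ j (levelTime r p α σ t x) = p j - x ∧
      α * p j ≤ workDone σ j (levelTime r p α σ t x) := by
  have hα := hinst.alpha_mem
  have h3 : 0 < 1 - α := by linarith [hα.2]
  have h4 := hα.1
  have hle := le_optRem_levelTime hinst h ht hj.1 hj.2.1
  have h1 := hle.trans (min_le_left _ _)
  have h2 := hle.trans (min_le_right _ _)
  rw [div_mul_eq_mul_div, le_div_iff₀ hα.1] at h1
  simp only [remT] at h2
  have heq : workDone σ j (levelTime r p α σ t x) = p j - x := by
    by_contra hne
    obtain ⟨u, hu, hua, hub, hpos⟩ := h.sched.exists_pos_of_climb (j := j)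
      (levelTime_le hinst ht) (a := workDone σ j (levelTime r p α σ t x))
      (b := min (workDone σ j t) (p j - x))
      (lt_min hj.2.2 (lt_of_le_of_ne (by linarith) hne)) le_rfl (min_le_left _ _)
    refine not_pos_of_level hα h ⟨hu.1, hu.2.le⟩ ?_ (hub.trans (min_le_right _ _)) hpos
    rw [div_mul_eq_mul_div, div_le_iff₀ h3]
    nlinarith
  exact ⟨heq, by nlinarith⟩

theorem workDone_le_of_levelTime_le (hinst : IsInstance r p α) (h : IsALG r p α σ) (ht : 0 ≤ t)
    (hx : 0 < x) {j : J} (hj : levelTime r p α σ t x ≤ r j) :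
    workDone σ j t ≤ x / (1 - α) := by
  have hα := hinst.alpha_mem
  have h3 : 0 < 1 - α := by linarith [hα.2]
  have hsum : α / (1 - α) * x + x = x / (1 - α) := by field_simp; ring
  have hpos : 0 ≤ α / (1 - α) * x := mul_nonneg (div_nonneg hα.1.le h3.le) hx.le
  by_contra! hlt
  have hp := h.sched.workDone_le t j
  obtain ⟨u, hu, hua, hub, hproc⟩ := h.sched.exists_pos_of_climb (j := j)
    (levelTime_le hinst ht) (a := α / (1 - α) * x) (b := min (workDone σ j t) (p j - x))
    (lt_min (by linarith) (by linarith))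
    (by rw [h.sched.workDone_of_le_release (hinst.r_nonneg j) hj]; exact hpos) (min_le_left _ _)
  exact not_pos_of_level hα h ⟨hu.1, hu.2.le⟩ hua (hub.trans (min_le_right _ _)) hproc

theorem not_crossesLevel_pair (hinst : IsInstance r p α) (h : IsALG r p α σ) (ht : 0 ≤ t)
    {i j : J} (hij : i ≠ j) {y : ℝ} (hxy : x < y)
    (hix : CrossesLevel r p α σ t x i) (hjx : CrossesLevel r p α σ t x j)
    (hiy : CrossesLevel r p α σ t y i) (hjy : CrossesLevel r p α σ t y j) : False := by
  have h1 := hix.workDone_eq hinst h ht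
  have h2 := hjx.workDone_eq hinst h ht
  have h3 := hiy.workDone_eq hinst h ht
  have h4 := hjy.workDone_eq hinst h ht
  have := h.workDone_eq_of_tied hinst.alpha_mem hij (levelTime_anti hinst ht hxy.le)
    hiy.1.le hjy.1.le h3.2 h4.2 hix.2.1 hjx.2.1 (by simp only [remT]; linarith)
  linarith

theorem finite_multiple_crossings (hinst : IsInstance r p α) (h : IsALG r p α σ) (ht : 0 ≤ t) :
    {x | ∃ i j, i ≠ j ∧ CrossesLevel r p α σ t x i ∧ CrossesLevel r p α σ t x j}.Finite := by
  have hsub : {x | ∃ i j, i ≠ j ∧ CrossesLevel r p α σ t x i ∧ CrossesLevel r p α σ t x j} ⊆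
      ⋃ q : J × J, {x | q.1 ≠ q.2 ∧ CrossesLevel r p α σ t x q.1 ∧
        CrossesLevel r p α σ t x q.2} := by
    rintro x ⟨i, j, hx⟩
    exact Set.mem_iUnion.2 ⟨(i, j), hx⟩
  refine (Set.finite_iUnion fun q => Set.Subsingleton.finite ?_).subset hsub
  rintro x ⟨hq, hx₁, hx₂⟩ y ⟨-, hy₁, hy₂⟩
  rcases lt_trichotomy x y with hlt | heq | hlt
  · exact (not_crossesLevel_pair hinst h ht hq hlt hx₁ hx₂ hy₁ hy₂).elim
  · exact heq
  · exact (not_crossesLevel_pair hinst h ht hq hlt hy₁ hy₂ hx₁ hx₂).elim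

theorem IsALG.sum_workDone_sub (hinst : IsInstance r p α) (h : IsALG r p α σ) (ht : 0 ≤ t) :
    ∑ j, (workDone σ j t - workDone σ j (levelTime r p α σ t x)) =
      t - levelTime r p α σ t x := by
  simp only [h.sched.workDone_sub]
  rw [← intervalIntegral.integral_finsetSum fun j _ => h.sched.intervalIntegrable j _ _]
  rw [intervalIntegral.integral_of_le (levelTime_le hinst ht),
    setIntegral_congr_fun (g := fun _ => (1 : ℝ)) measurableSet_Ioc fun u hu => ?_]
  · simp [levelTime_le hinst ht]
  · obtain ⟨j, hj, -⟩ := exists_optRem_lt hu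
    exact h.nonidling u ⟨j, hj⟩

end levelTime

theorem IsSchedule.sum_workDone_sub_le {J : Type*} [Fintype J] {r p : J → ℝ} {σ : ℝ → J → ℝ}
    (h : IsSchedule r p σ) {a b : ℝ} (hab : a ≤ b) :
    ∑ j, (workDone σ j b - workDone σ j a) ≤ b - a := by
  simp only [h.workDone_sub]
  rw [← intervalIntegral.integral_finsetSum fun j _ => h.intervalIntegrable j _ _]
  have hint : IntervalIntegrable (fun v => ∑ j, σ v j) volume a b := by
    simpa only [Finset.sum_fn] using
      IntervalIntegrable.sum Finset.univ fun j _ => h.intervalIntegrable j a b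
  simpa using intervalIntegral.integral_mono_on hab hint
    (intervalIntegrable_const (c := (1 : ℝ))) fun u _ => h.sum_le_one u

section

variable {J : Type*} [Fintype J] {r p : J → ℝ} {α : ℝ} {σ σO : ℝ → J → ℝ} {t x : ℝ}

theorem sum_remT_le_add_crossings (hinst : IsInstance r p α) (h : IsALG r p α σ)
    (hO : IsSchedule r p σO) (ht : 0 ≤ t) (hx : 0 < x) :
    ∑ j, (if (availAt r p σ t j ∧ ¬ availAt r p σO t j) ∧ remT p σ j t < x
        then remT p σ j t else 0) ≤
      ∑ j, (if availAt r p σO t j ∧ workDone σ j t ≤ x / (1 - α) then workDone σ j t else 0) +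
      ∑ j, (if CrossesLevel r p α σ t x j then x else 0) := by
  set s := levelTime r p α σ t x with hs
  have hst : s ≤ t := levelTime_le hinst ht
  have hA := h.sum_workDone_sub (x := x) hinst ht
  have hB := hO.sum_workDone_sub_le hst
  have key : ∀ j, (if (availAt r p σ t j ∧ ¬ availAt r p σO t j) ∧ remT p σ j t < x
        then remT p σ j t else 0) ≤
      (if availAt r p σO t j ∧ workDone σ j t ≤ x / (1 - α) then workDone σ j t else 0) +
      (if CrossesLevel r p α σ t x j then x else 0) +
      ((workDone σO j t - workDone σO j s) - (workDone σ j t - workDone σ j s)) := by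
    intro j
    have hr := hinst.r_nonneg j
    have hy0 := h.sched.workDone_nonneg hr t
    have hyp := h.sched.workDone_le t j
    have hm := h.sched.workDone_mono j hst
    have hmO := hO.workDone_mono j hst
    have hg : 0 ≤ (if availAt r p σO t j ∧ workDone σ j t ≤ x / (1 - α)
        then workDone σ j t else 0) := by split_ifs <;> simp [hy0]
    have hχ : 0 ≤ (if CrossesLevel r p α σ t x j then x else 0) := by
      split_ifs <;> simp [hx.le]
    have hd : (if (availAt r p σ t j ∧ ¬ availAt r p σO t j) ∧ remT p σ j t < x
        then remT p σ j t else 0) ≤ remT p σ j t := by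
      have : 0 ≤ remT p σ j t := sub_nonneg.2 hyp
      split_ifs <;> simp [this]
    have hd0 : ¬((availAt r p σ t j ∧ ¬ availAt r p σO t j) ∧ remT p σ j t < x) →
        (if (availAt r p σ t j ∧ ¬ availAt r p σO t j) ∧ remT p σ j t < x
          then remT p σ j t else 0) = 0 := fun hc => if_neg hc
    have hrem : remT p σ j t = p j - workDone σ j t := rfl
    rcases le_or_gt s (r j) with hnew | hold
    · have hs0 := h.sched.workDone_of_le_release hr hnew
      have hsO := hO.workDone_of_le_release hr hnew
      rcases lt_or_ge t (r j) with htr | htr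
      · have h1 := h.sched.workDone_of_le_release hr htr.le
        have h2 := hd0 fun hc => absurd hc.1.1.1 (not_le.2 htr)
        linarith
      · by_cases hav : availAt r p σO t j
        · have h1 := workDone_le_of_levelTime_le hinst h ht hx hnew
          have h2 := hd0 fun hc => hc.1.2 hav
          rw [if_pos (show availAt r p σO t j ∧ workDone σ j t ≤ x / (1 - α) from ⟨hav, h1⟩)]
          linarith
        · have h1 : workDone σO j t = p j := by
            refine le_antisymm (hO.workDone_le t j) (le_of_not_gt fun hc => hav ?_)
            exact hO.availAt_iff.2 ⟨htr, hc⟩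
          linarith
    · rcases (h.sched.workDone_le s j).lt_or_eq with hal | hdone
      · by_cases hcr : CrossesLevel r p α σ t x j
        · have := (hcr.workDone_eq hinst h ht).1
          rw [if_pos hcr]
          linarith
        · have h1 : workDone σ j t = workDone σ j s :=
            le_antisymm (le_of_not_gt fun hc => hcr ⟨hold, hal, hc⟩) hm
          have h2 := (le_optRem_levelTime hinst h ht hold hal).trans (min_le_right _ _)
          rw [remT, ← hs, ← h1, ← hrem] at h2
          have h3 := hd0 fun hc => absurd hc.2 (not_lt.2 h2)
          linarith
      · have h1 := hd0 fun hc => by linarith [(h.sched.availAt_iff.1 hc.1.1).2]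
        linarith
  have hsum := Finset.sum_le_sum fun j (_ : j ∈ Finset.univ) => key j
  simp only [Finset.sum_add_distrib, Finset.sum_sub_distrib] at hsum hA hB ⊢
  linarith

end

theorem integrableOn_ite_mul_rpow {c : ℝ} (hc : 0 < c) :
    IntegrableOn (fun x => (if c ≤ x then c else 0) * x ^ (-2 : ℝ)) (Set.Ioi 0) := by
  have h1 : IntegrableOn (fun x : ℝ => c * x ^ (-2 : ℝ)) (Set.Ici c) :=
    ((integrableOn_Ici_iff_integrableOn_Ioi).2
      (integrableOn_Ioi_rpow_of_lt (by norm_num) hc)).const_mul c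
  refine (((integrable_indicator_iff measurableSet_Ici).2 h1).congr ?_).integrableOn
  refine Filter.Eventually.of_forall fun x => ?_
  by_cases hx : c ≤ x <;> simp [hx]

theorem integral_ite_mul_rpow {c : ℝ} (hc : 0 < c) :
    ∫ x in Set.Ioi 0, (if c ≤ x then c else 0) * x ^ (-2 : ℝ) = 1 := by
  have h1 : (fun x : ℝ => (if c ≤ x then c else 0) * x ^ (-2 : ℝ)) =
      (Set.Ici c).indicator fun x => c * x ^ (-2 : ℝ) := by
    ext x
    by_cases hx : c ≤ x <;> simp [hx]
  rw [h1, setIntegral_indicator measurableSet_Ici,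
    Set.inter_eq_right.2 (Set.Ici_subset_Ioi.2 hc), integral_Ici_eq_integral_Ioi,
    integral_const_mul, integral_Ioi_rpow_of_lt (by norm_num) hc]
  norm_num
  rw [Real.rpow_neg_one, mul_inv_cancel₀ hc.ne']

theorem card_le_mul_card_of_sum_le {ι : Type*} {D O : Finset ι} {z c : ι → ℝ} {K : ℝ}
    (hK : 0 ≤ K) (hz : ∀ j ∈ D, 0 < z j) (hc : ∀ i ∈ O, 0 ≤ c i)
    (h : ∀ x > 0, ∑ j ∈ D with z j ≤ x, z j ≤ K * ∑ i ∈ O with c i ≤ x, c i) :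
    (D.card : ℝ) ≤ K * O.card := by
  have hsub : ∀ x, ∑ i ∈ O.filter (0 < c ·) with c i ≤ x, c i = ∑ i ∈ O with c i ≤ x, c i := by
    intro x
    rw [Finset.filter_comm]
    exact Finset.sum_filter_of_ne fun i hi hne =>
      lt_of_le_of_ne (hc i (Finset.mem_filter.1 hi).1) (Ne.symm hne)
  have hint : ∀ (s : Finset ι) (f : ι → ℝ), (∀ i ∈ s, 0 < f i) →
      IntegrableOn (fun x => (∑ i ∈ s with f i ≤ x, f i) * x ^ (-2 : ℝ)) (Set.Ioi 0) ∧
      ∫ x in Set.Ioi 0, (∑ i ∈ s with f i ≤ x, f i) * x ^ (-2 : ℝ) = s.card := by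
    intro s f hf
    simp only [Finset.sum_filter, Finset.sum_mul]
    refine ⟨integrable_finsetSum _ fun i hi => integrableOn_ite_mul_rpow (hf i hi), ?_⟩
    rw [integral_finsetSum _ fun i hi => integrableOn_ite_mul_rpow (hf i hi),
      Finset.sum_congr rfl fun i hi => integral_ite_mul_rpow (hf i hi)]
    simp
  obtain ⟨hD, hDc⟩ := hint D z hz
  obtain ⟨hO, hOc⟩ := hint (O.filter (0 < c ·)) c fun i hi => (Finset.mem_filter.1 hi).2
  have hle := setIntegral_mono_on hD (hO.const_mul K) measurableSet_Ioi fun x hx => by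
    rw [hsub, ← mul_assoc]
    exact mul_le_mul_of_nonneg_right (h x hx) (Real.rpow_nonneg (le_of_lt hx) _)
  rw [integral_const_mul, hDc, hOc] at hle
  refine hle.trans (mul_le_mul_of_nonneg_left ?_ hK)
  exact_mod_cast Finset.card_filter_le _ _

/-- An additive error `x` costs at most one extra element per gap between the values `c`. -/
theorem card_le_of_sum_le_add {ι : Type*} {D O : Finset ι} {z c : ι → ℝ} {K : ℝ}
    (hK : 0 ≤ K) (hz : ∀ j ∈ D, 0 < z j) (hc : ∀ i ∈ O, 0 ≤ c i)
    (h : ∀ x > 0, ∑ j ∈ D with z j ≤ x, z j ≤ K * ∑ i ∈ O with c i ≤ x, c i + x) :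
    (D.card : ℝ) ≤ (K + 1) * O.card + 1 := by
  classical
  rcases D.eq_empty_or_nonempty with rfl | ⟨d, -⟩
  · simp only [Finset.card_empty, Nat.cast_zero]
    positivity
  set g : ι → ℕ := fun j => (O.filter (c · ≤ z j)).card with hg
  have hmax : ∀ n, ∃ l, n ∈ D.image g → l ∈ D ∧ g l = n ∧ ∀ j ∈ D, g j = n → z j ≤ z l := by
    intro n
    by_cases hn : n ∈ D.image g
    · obtain ⟨j₀, hj₀, rfl⟩ := Finset.mem_image.1 hn
      obtain ⟨l, hl, hlmax⟩ := (D.filter (g · = g j₀)).exists_max_image z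
        ⟨j₀, Finset.mem_filter.2 ⟨hj₀, rfl⟩⟩
      rw [Finset.mem_filter] at hl
      exact ⟨l, fun _ => ⟨hl.1, hl.2, fun j hj hjn => hlmax j (Finset.mem_filter.2 ⟨hj, hjn⟩)⟩⟩
    · exact ⟨d, fun h => absurd h hn⟩
  choose l hl using hmax
  have hL : ((D.image g).image l).card ≤ O.card + 1 := by
    refine Finset.card_image_le.trans ((Finset.card_le_card
      (t := Finset.range (O.card + 1)) fun n hn => ?_).trans (Finset.card_range _).le)
    obtain ⟨j, -, rfl⟩ := Finset.mem_image.1 hn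
    exact Finset.mem_range.2 (Nat.lt_succ_of_le (Finset.card_filter_le _ _))
  have hclean : ((D \ (D.image g).image l).card : ℝ) ≤ K * O.card := by
    refine card_le_mul_card_of_sum_le hK (fun j hj => hz j (Finset.mem_sdiff.1 hj).1) hc
      fun x _ => ?_
    rcases ((D \ (D.image g).image l).filter (z · ≤ x)).eq_empty_or_nonempty with he | hne
    · rw [he, Finset.sum_empty]
      exact mul_nonneg hK (Finset.sum_nonneg fun i hi => hc i (Finset.mem_filter.1 hi).1)
    · obtain ⟨j, hj, hjmax⟩ := Finset.exists_max_image _ z hne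
      simp only [Finset.mem_filter, Finset.mem_sdiff] at hj hjmax
      have hgj := Finset.mem_image_of_mem g hj.1.1
      obtain ⟨hlD, hlg, hlmax⟩ := hl (g j) hgj
      have hjl := hlmax j hj.1.1 rfl
      have hset : O.filter (c · ≤ z j) = O.filter (c · ≤ z (l (g j))) :=
        Finset.eq_of_subset_of_card_le
          (Finset.monotone_filter_right _ fun i _ hi => hi.trans hjl) hlg.le
      have h1 := h (z (l (g j))) (hz _ hlD)
      have hmem : l (g j) ∈ D.filter (z · ≤ z (l (g j))) := Finset.mem_filter.2 ⟨hlD, le_rfl⟩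
      rw [← hset, ← Finset.sum_erase_add _ _ hmem] at h1
      refine (Finset.sum_le_sum_of_subset_of_nonneg (fun k hk => ?_) fun k hk _ => ?_).trans
        ((le_of_add_le_add_right h1).trans (mul_le_mul_of_nonneg_left ?_ hK))
      · have hk' := hk
        simp only [Finset.mem_filter, Finset.mem_sdiff] at hk'
        refine Finset.mem_erase.2 ⟨?_, Finset.mem_filter.2 ⟨hk'.1.1, (hjmax k hk').trans hjl⟩⟩
        rintro rfl
        exact hk'.1.2 (Finset.mem_image_of_mem l hgj)
      · exact (hz k (Finset.mem_filter.1 (Finset.mem_of_mem_erase hk)).1).le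
      · exact Finset.sum_le_sum_of_subset_of_nonneg
          (Finset.monotone_filter_right _ fun i _ hi => hi.trans hj.2)
          fun i hi _ => hc i (Finset.mem_filter.1 hi).1
  have hcard : (D.card : ℝ) ≤ (D \ (D.image g).image l).card + ((D.image g).image l).card := by
    exact_mod_cast Finset.card_le_card_sdiff_add_card
  have hL' : (((D.image g).image l).card : ℝ) ≤ O.card + 1 := by exact_mod_cast hL
  linarith

/-- Strict cutoffs just above `x` yield the bound with a weak cutoff at `x`. -/
theorem sum_le_add_of_generic {ι : Type*} {D O : Finset ι} {z c : ι → ℝ} {K : ℝ} {S : Set ℝ}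
    (hz : ∀ j ∈ D, 0 < z j) (hS : S.Finite)
    (h : ∀ x > 0, x ∉ S →
      ∑ j ∈ D with z j < x, z j ≤ K * ∑ i ∈ O with c i ≤ x, c i + x) {x : ℝ} (hx : 0 < x) :
    ∑ j ∈ D with z j ≤ x, z j ≤ K * ∑ i ∈ O with c i ≤ x, c i + x := by
  have hO : ∀ᶠ x' in nhdsWithin x (Set.Ioi x), O.filter (c · ≤ x') = O.filter (c · ≤ x) := by
    have h1 : ∀ i ∈ O, ∀ᶠ x' in nhdsWithin x (Set.Ioi x), (c i ≤ x' ↔ c i ≤ x) := by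
      intro i _
      rcases le_or_gt (c i) x with hi | hi
      · filter_upwards [self_mem_nhdsWithin] with x' hx'
        exact iff_of_true (hi.trans (le_of_lt hx')) hi
      · filter_upwards [nhdsWithin_le_nhds (eventually_lt_nhds hi)] with x' hx'
        exact iff_of_false (not_le.2 hx') (not_le.2 hi)
    filter_upwards [(Finset.eventually_all O).2 h1] with x' hx'
    exact Finset.filter_congr hx'
  have hgen : ∀ᶠ x' in nhdsWithin x (Set.Ioi x), x' ∉ S := by
    have h1 : (S \ {x})ᶜ ∈ nhds x := (hS.subset Set.sdiff_subset).isClosed.isOpen_compl.mem_nhds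
      (by simp)
    filter_upwards [nhdsWithin_le_nhds h1, self_mem_nhdsWithin] with x' hx' hlt hmem
    exact hx' ⟨hmem, (ne_of_gt hlt)⟩
  have hlim : Filter.Tendsto (fun x' => K * ∑ i ∈ O with c i ≤ x, c i + x')
      (nhdsWithin x (Set.Ioi x)) (nhds (K * ∑ i ∈ O with c i ≤ x, c i + x)) :=
    ((continuous_const.add continuous_id).tendsto x).mono_left nhdsWithin_le_nhds
  refine ge_of_tendsto hlim ?_
  filter_upwards [hO, hgen, self_mem_nhdsWithin] with x' h1 h2 h3
  rw [← h1]
  refine le_trans (Finset.sum_le_sum_of_subset_of_nonneg ?_ fun j hj _ => ?_)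
    (h x' (hx.trans h3) h2)
  · exact Finset.monotone_filter_right _ fun j _ hj => lt_of_le_of_lt hj h3
  · exact (hz j (Finset.mem_filter.1 hj).1).le

/-- **Local competitiveness.** For an ALG-schedule `σ` and any
schedule `σO`, if `1/(1-α)` is an integer then
`|A(t) ∖ O(t)| ≤ (3 + 2/(1-α))·|O(t)|` for all `t ≥ 0`. -/
theorem stmt9 {J : Type*} [Fintype J] {r p : J → ℝ} {α : ℝ} {σ σO : ℝ → J → ℝ}
    (hinst : IsInstance r p α) (hint : ∃ n : ℕ, 1 / (1 - α) = (n : ℝ))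
    (halg : IsALG r p α σ) (hO : IsSchedule r p σO) (t : ℝ) (ht : 0 ≤ t) :
    (({j | availAt r p σ t j ∧ ¬ availAt r p σO t j} : Set J).ncard : ℝ)
      ≤ (3 + 2 / (1 - α)) * (({j | availAt r p σO t j} : Set J).ncard : ℝ) := by
  set D : Finset J := {j | availAt r p σ t j ∧ ¬ availAt r p σO t j} with hD
  set O : Finset J := {j | availAt r p σO t j} with hOdef
  have hDcard : ({j | availAt r p σ t j ∧ ¬ availAt r p σO t j} : Set J).ncard = D.card := by
    rw [← Set.ncard_coe_finset]; simp [hD]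
  have hOcard : ({j | availAt r p σO t j} : Set J).ncard = O.card := by
    rw [← Set.ncard_coe_finset]; simp [hOdef]
  rw [hDcard, hOcard]
  have h3 : 0 < 1 - α := by linarith [hinst.alpha_mem.2]
  have hz : ∀ j ∈ D, 0 < remT p σ j t := fun j hj =>
    sub_pos.2 (halg.sched.availAt_iff.1 (Finset.mem_filter.1 hj).2.1).2
  have hmain : ∀ x > 0, ∑ j ∈ D with remT p σ j t < x, remT p σ j t ≤
      1 / (1 - α) * ∑ i ∈ O with (1 - α) * workDone σ i t ≤ x, (1 - α) * workDone σ i t +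
      ∑ j, (if CrossesLevel r p α σ t x j then x else 0) := by
    intro x hx
    have h1 := sum_remT_le_add_crossings hinst halg hO ht hx
    simp only [← Finset.sum_filter, le_div_iff₀' h3] at h1
    rw [← Finset.mul_sum, ← mul_assoc, one_div_mul_cancel h3.ne', one_mul, hD, hOdef,
      Finset.filter_filter, Finset.filter_filter]
    simpa only [← Finset.sum_filter] using h1
  have hbound : ∀ x > 0, ∑ j ∈ D with remT p σ j t ≤ x, remT p σ j t ≤
      1 / (1 - α) * ∑ i ∈ O with (1 - α) * workDone σ i t ≤ x, (1 - α) * workDone σ i t + x := by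
    intro x hx
    refine sum_le_add_of_generic hz (finite_multiple_crossings hinst halg ht)
      (fun x hx hxS => (hmain x hx).trans ?_) hx
    gcongr
    by_cases hcr : ∃ j, CrossesLevel r p α σ t x j
    · obtain ⟨j, hj⟩ := hcr
      rw [Finset.sum_eq_single j (fun i _ hij => if_neg fun hi => hxS ⟨i, j, hij, hi, hj⟩)
        (by simp), if_pos hj]
    · simp only [not_exists] at hcr
      simp [hcr, hx.le]
  have hcard := card_le_of_sum_le_add (by positivity) hz
    (fun i _ => mul_nonneg h3.le (halg.sched.workDone_nonneg (hinst.r_nonneg i) t)) hbound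
  rcases O.eq_empty_or_nonempty with hO0 | hOne
  · have hD0 : D = ∅ := by
      by_contra hne
      obtain ⟨j₀, hj₀⟩ := Finset.nonempty_iff_ne_empty.2 hne
      set x := ∑ j, p j + 1 with hxdef
      have hpx : ∀ j, p j < x := fun j => by
        have := Finset.single_le_sum (fun i _ => (hinst.p_pos i).le) (Finset.mem_univ j)
        linarith
      have hx : 0 < x := (hinst.p_pos j₀).trans (hpx j₀)
      have hy := fun j u => halg.sched.workDone_nonneg (hinst.r_nonneg j) u
      have hcr : ∀ j, ¬ CrossesLevel r p α σ t x j := fun j hj => by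
        have h1 := (hj.workDone_eq hinst halg ht).1
        have h2 := hy j (levelTime r p α σ t x)
        linarith [hpx j]
      have h1 := hmain x hx
      simp only [hO0, hcr, Finset.filter_empty, Finset.sum_empty, mul_zero, if_false,
        Finset.sum_const_zero, add_zero] at h1
      have hall : D.filter (remT p σ · t < x) = D := Finset.filter_true_of_mem fun j _ => by
        have := hy j t
        simp only [remT]
        linarith [hpx j]
      rw [hall] at h1
      exact absurd h1 (not_le.2 (Finset.sum_pos hz ⟨j₀, hj₀⟩))
    simp [hO0, hD0]
  · have h1 : (1 : ℝ) ≤ O.card := by exact_mod_cast hOne.card_pos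
    have h2 : 0 < 1 / (1 - α) := one_div_pos.2 h3
    have h4 : 2 / (1 - α) = 2 * (1 / (1 - α)) := by ring
    rw [h4]
    nlinarith
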